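/- arXiv:2305.15034 — 2 statements merged into one kernel-verified Lean document; each statement's English description precedes it below -/
import Mathlib

section
/- The kernel l is infinitely differentiable on (0,∞), and for every t > 0 it satisfies the upper bound l(t) ≤ 1 / ∫_{(0,1]} t^{1−α} dμ(α). -/
open MeasureTheory Real

/-- `μ` is a nonzero distributed-order measure supported in `(0,1]`: it has the form
`Σₙ qₙ δ_{αₙ} + w·(Lebesgue on (0,1))` with `0 < α₁ < ⋯ < α_M < 1`, `qₙ ≥ 0`, and a
nonnegative weight `w ∈ L¹((0,1))` (either part may vanish, but `μ ≠ 0`). -/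
def IsDistOrderMeasure (μ : Measure ℝ) : Prop :=
  μ ≠ 0 ∧
  ∃ (M : ℕ) (α : Fin M → ℝ) (q : Fin M → ℝ) (w : ℝ → ℝ),
    StrictMono α ∧ (∀ n, α n ∈ Set.Ioo (0:ℝ) 1) ∧ (∀ n, 0 ≤ q n) ∧
    (∀ x ∈ Set.Ioo (0:ℝ) 1, 0 ≤ w x) ∧
    MeasureTheory.IntegrableOn w (Set.Ioo 0 1) ∧
    μ = (∑ n, ENNReal.ofReal (q n) • MeasureTheory.Measure.dirac (α n)) +
        ((MeasureTheory.volume.restrict (Set.Ioo (0:ℝ) 1)).withDensity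
          fun x => ENNReal.ofReal (w x))

/-- The kernel `k(t) = ∫_{(0,1]} t^{−α}/Γ(1−α) dμ(α)`. -/
noncomputable def kker (μ : Measure ℝ) (t : ℝ) : ℝ :=
  ∫ a in Set.Ioc (0:ℝ) 1, t ^ (-a) / Real.Gamma (1 - a) ∂μ

/-- `H(r)` from the representation formula for the kernel `l`. -/
noncomputable def Hker (μ : Measure ℝ) (r : ℝ) : ℝ :=
  (∫ a in Set.Ioc (0:ℝ) 1, r ^ a * Real.sin (Real.pi * a) ∂μ) /
    ((∫ a in Set.Ioc (0:ℝ) 1, r ^ a * Real.sin (Real.pi * a) ∂μ) ^ 2 +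
     (∫ a in Set.Ioc (0:ℝ) 1, r ^ a * Real.cos (Real.pi * a) ∂μ) ^ 2)

/-- The kernel `l(t) = (1/π) ∫₀^∞ e^{−rt} H(r) dr`. -/
noncomputable def lker (μ : Measure ℝ) (t : ℝ) : ℝ :=
  (1 / Real.pi) * ∫ r in Set.Ioi (0:ℝ), Real.exp (-(r * t)) * Hker μ r

open ProbabilityTheory Filter Topology

/-- `S(e^u) = ∫ e^{ua} sin(πa) dμ(a)`. -/
noncomputable def expSin (μ : Measure ℝ) (u : ℝ) : ℝ := ∫ a, exp (u * a) * sin (π * a) ∂μ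

section Symbol

variable {μ : Measure ℝ} [IsFiniteMeasure μ]

lemma integrable_of_continuousOn_of_ae_mem_Ioo {E : Type*} [NormedAddCommGroup E]
    [SecondCountableTopologyEither ℝ E]
    (hs : ∀ᵐ a ∂μ, a ∈ Set.Ioo (0 : ℝ) 1) {f : ℝ → E} (hf : Continuous f) : Integrable f μ := by
  obtain ⟨C, hC⟩ := isCompact_Icc.exists_bound_of_continuousOn (hf.continuousOn (s := Set.Icc 0 1))
  refine Integrable.of_bound hf.aestronglyMeasurable C ?_
  filter_upwards [hs] with a ha using hC a ⟨ha.1.le, ha.2.le⟩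

lemma integral_pos_of_ae_mem_Ioo (hμ : μ ≠ 0)
    (hs : ∀ᵐ a ∂μ, a ∈ Set.Ioo (0 : ℝ) 1) {f : ℝ → ℝ} (hf : Continuous f)
    (hpos : ∀ a ∈ Set.Ioo (0 : ℝ) 1, 0 < f a) : 0 < ∫ a, f a ∂μ := by
  rw [integral_pos_iff_support_of_nonneg_ae
    (by filter_upwards [hs] with a ha using (hpos a ha).le)
    (integrable_of_continuousOn_of_ae_mem_Ioo hs hf)]
  refine pos_iff_ne_zero.2 fun h0 => hμ ?_
  have h1 : ∀ᵐ a ∂μ, a ∉ Function.support f := measure_eq_zero_iff_ae_notMem.1 h0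
  have : ∀ᵐ a ∂μ, False := by
    filter_upwards [hs, h1] with a ha h using h (hpos a ha).ne'
  simpa using this

lemma integrableExpSet_eq_univ (hs : ∀ᵐ a ∂μ, a ∈ Set.Ioo (0 : ℝ) 1) :
    integrableExpSet id μ = Set.univ :=
  Set.eq_univ_of_forall fun t => integrable_of_continuousOn_of_ae_mem_Ioo hs
    (f := fun a => exp (t * id a)) (by simp only [id]; fun_prop)

lemma differentiable_complexMGF (hs : ∀ᵐ a ∂μ, a ∈ Set.Ioo (0 : ℝ) 1) :
    Differentiable ℂ (complexMGF id μ) := fun z =>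
  (hasDerivAt_complexMGF (by simp [integrableExpSet_eq_univ hs])).differentiableAt

lemma sin_pi_mul_pos {a : ℝ} (ha : a ∈ Set.Ioo (0 : ℝ) 1) : 0 < sin (π * a) :=
  sin_pos_of_pos_of_lt_pi (mul_pos pi_pos ha.1) (by nlinarith [pi_pos, ha.2])

lemma expSin_pos (hμ : μ ≠ 0) (hs : ∀ᵐ a ∂μ, a ∈ Set.Ioo (0 : ℝ) 1) (u : ℝ) : 0 < expSin μ u :=
  integral_pos_of_ae_mem_Ioo hμ hs (by fun_prop) fun _ ha =>
    mul_pos (exp_pos _) (sin_pi_mul_pos ha)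

lemma expSin_le_norm_complexMGF (hs : ∀ᵐ a ∂μ, a ∈ Set.Ioo (0 : ℝ) 1) (u : ℝ) {θ : ℝ}
    (hθ : |θ| ≤ π) : expSin μ u ≤ ‖complexMGF id μ (u + θ * Complex.I)‖ := by
  have hint : Integrable (fun a : ℝ =>
      Complex.exp (-(θ / 2 * Complex.I)) * Complex.exp ((u + θ * Complex.I) * a)) μ :=
    integrable_of_continuousOn_of_ae_mem_Ioo hs (by fun_prop)
  have hre (a : ℝ) : (Complex.exp (-(θ / 2 * Complex.I)) *
      Complex.exp ((u + θ * Complex.I) * a)).re = exp (u * a) * cos (θ * (a - 1 / 2)) := by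
    rw [← Complex.exp_add, Complex.exp_re]
    congr 2
    · simp
    · simp
      ring
  have h1 : expSin μ u ≤
      (Complex.exp (-(θ / 2 * Complex.I)) * complexMGF id μ (u + θ * Complex.I)).re := by
    rw [complexMGF, ← integral_const_mul]
    refine le_of_le_of_eq ?_ (integral_re hint)
    refine integral_mono_ae (integrable_of_continuousOn_of_ae_mem_Ioo hs (by fun_prop))
      hint.re ?_
    filter_upwards [hs] with a ha
    have := hre a
    simp only [RCLike.re_to_complex] at this ⊢
    rw [this]
    gcongr
    rw [← cos_abs (θ * _), ← cos_pi_div_two_sub, ← cos_abs (π / 2 - _)]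
    have e : |π / 2 - π * a| = π * |a - 1 / 2| := by
      rw [abs_sub_comm, show π * a - π / 2 = π * (a - 1 / 2) by ring, abs_mul, abs_of_pos pi_pos]
    rw [e, abs_mul]
    have : |a - 1 / 2| ≤ 1 / 2 := abs_le.2 ⟨by linarith [ha.1], by linarith [ha.2]⟩
    refine cos_le_cos_of_nonneg_of_le_pi (by positivity) ?_ (by gcongr)
    nlinarith [pi_pos]
  refine h1.trans ((Complex.re_le_norm _).trans ?_)
  rw [norm_mul, show -((θ : ℂ) / 2 * Complex.I) = ((-(θ / 2) : ℝ) : ℂ) * Complex.I by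
    push_cast; ring, Complex.norm_exp_ofReal_mul_I, one_mul]

lemma complexMGF_ne_zero (hμ : μ ≠ 0) (hs : ∀ᵐ a ∂μ, a ∈ Set.Ioo (0 : ℝ) 1) {z : ℂ}
    (hz : |z.im| ≤ π) : complexMGF id μ z ≠ 0 := by
  have h := (expSin_pos hμ hs z.re).trans_le (expSin_le_norm_complexMGF hs z.re hz)
  rw [Complex.re_add_im] at h
  exact norm_pos_iff.1 h

lemma tendsto_expSin_atTop (hμ : μ ≠ 0) (hs : ∀ᵐ a ∂μ, a ∈ Set.Ioo (0 : ℝ) 1) :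
    Tendsto (expSin μ) atTop atTop := by
  have h1 : 0 < ∫ a, a * sin (π * a) ∂μ := integral_pos_of_ae_mem_Ioo hμ hs (by fun_prop)
    fun a ha => mul_pos ha.1 (sin_pi_mul_pos ha)
  refine tendsto_atTop_mono (f := fun u => u * ∫ a, a * sin (π * a) ∂μ) (fun u => ?_)
    (tendsto_id.atTop_mul_const h1)
  rw [← integral_const_mul]
  refine integral_mono_ae (integrable_of_continuousOn_of_ae_mem_Ioo hs (by fun_prop))
    (integrable_of_continuousOn_of_ae_mem_Ioo hs (by fun_prop)) ?_
  filter_upwards [hs] with a ha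
  have := sin_pi_mul_pos ha
  simp only [← mul_assoc]
  gcongr
  linarith [add_one_le_exp (u * a)]

lemma tendsto_exp_mul_expSin_neg_atTop (hμ : μ ≠ 0) (hs : ∀ᵐ a ∂μ, a ∈ Set.Ioo (0 : ℝ) 1) :
    Tendsto (fun u => exp u * expSin μ (-u)) atTop atTop := by
  have h1 : 0 < ∫ a, (1 - a) * sin (π * a) ∂μ := integral_pos_of_ae_mem_Ioo hμ hs (by fun_prop)
    fun a ha => mul_pos (by linarith [ha.2]) (sin_pi_mul_pos ha)
  refine tendsto_atTop_mono (f := fun u => u * ∫ a, (1 - a) * sin (π * a) ∂μ) (fun u => ?_)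
    (tendsto_id.atTop_mul_const h1)
  rw [← integral_const_mul, expSin, ← integral_const_mul]
  refine integral_mono_ae (integrable_of_continuousOn_of_ae_mem_Ioo hs (by fun_prop))
    (integrable_of_continuousOn_of_ae_mem_Ioo hs (by fun_prop)) ?_
  filter_upwards [hs] with a ha
  have := sin_pi_mul_pos ha
  simp only [← mul_assoc, ← exp_add]
  gcongr
  linarith [add_one_le_exp (u + -u * a)]

end Symbol

section Contour

variable {μ : Measure ℝ} [IsFiniteMeasure μ]

/-- `C(e^u) = ∫ e^{ua} cos(πa) dμ(a)`. -/
noncomputable def expCos (μ : Measure ℝ) (u : ℝ) : ℝ := ∫ a, exp (u * a) * cos (π * a) ∂μ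

lemma complexMGF_add_pi_mul_I (hs : ∀ᵐ a ∂μ, a ∈ Set.Ioo (0 : ℝ) 1) (u : ℝ) :
    complexMGF id μ (u + π * Complex.I) = expCos μ u + expSin μ u * Complex.I := by
  have hint : Integrable (fun a : ℝ => Complex.exp ((u + π * Complex.I) * a)) μ :=
    integrable_of_continuousOn_of_ae_mem_Ioo hs (by fun_prop)
  have h1 := integral_re hint
  have h2 := integral_im hint
  simp only [RCLike.re_to_complex, RCLike.im_to_complex, Complex.exp_re, Complex.exp_im] at h1 h2
  apply Complex.ext
  · refine h1.symm.trans ?_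
    simp [expCos]
  · refine h2.symm.trans ?_
    simp [expSin]

lemma complexMGF_sub_pi_mul_I (hs : ∀ᵐ a ∂μ, a ∈ Set.Ioo (0 : ℝ) 1) (u : ℝ) :
    complexMGF id μ (u - π * Complex.I) = expCos μ u - expSin μ u * Complex.I := by
  have h : (starRingEnd ℂ) (complexMGF id μ (u + π * Complex.I)) =
      complexMGF id μ (u - π * Complex.I) := by
    rw [complexMGF, ← integral_conj, complexMGF]
    congr 1 with a
    simp [← Complex.exp_conj, sub_eq_add_neg]
  rw [← h, complexMGF_add_pi_mul_I hs]
  simp [sub_eq_add_neg]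

lemma continuous_expSin (hs : ∀ᵐ a ∂μ, a ∈ Set.Ioo (0 : ℝ) 1) : Continuous (expSin μ) := by
  have h : expSin μ = fun u : ℝ => (complexMGF id μ (u + π * Complex.I)).im := by
    ext u; simp [complexMGF_add_pi_mul_I hs]
  have := (differentiable_complexMGF hs).continuous
  rw [h]; fun_prop

lemma continuous_expCos (hs : ∀ᵐ a ∂μ, a ∈ Set.Ioo (0 : ℝ) 1) : Continuous (expCos μ) := by
  have h : expCos μ = fun u : ℝ => (complexMGF id μ (u + π * Complex.I)).re := by
    ext u; simp [complexMGF_add_pi_mul_I hs]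
  have := (differentiable_complexMGF hs).continuous
  rw [h]; fun_prop

/-- `H(e^u)`, the jump of the reciprocal symbol across the cut. -/
noncomputable def expH (μ : Measure ℝ) (u : ℝ) : ℝ :=
  expSin μ u / (expSin μ u ^ 2 + expCos μ u ^ 2)

lemma expH_denom_pos (hμ : μ ≠ 0) (hs : ∀ᵐ a ∂μ, a ∈ Set.Ioo (0 : ℝ) 1) (u : ℝ) :
    0 < expSin μ u ^ 2 + expCos μ u ^ 2 := by
  have := expSin_pos hμ hs u
  positivity

lemma continuous_expH (hμ : μ ≠ 0) (hs : ∀ᵐ a ∂μ, a ∈ Set.Ioo (0 : ℝ) 1) :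
    Continuous (expH μ) :=
  (continuous_expSin hs).div (((continuous_expSin hs).pow 2).add ((continuous_expCos hs).pow 2))
    fun u => (expH_denom_pos hμ hs u).ne'

lemma expH_nonneg (hμ : μ ≠ 0) (hs : ∀ᵐ a ∂μ, a ∈ Set.Ioo (0 : ℝ) 1) (u : ℝ) :
    0 ≤ expH μ u := div_nonneg (expSin_pos hμ hs u).le (expH_denom_pos hμ hs u).le

lemma inv_complexMGF_jump (hμ : μ ≠ 0) (hs : ∀ᵐ a ∂μ, a ∈ Set.Ioo (0 : ℝ) 1) (u : ℝ) :
    (complexMGF id μ (u - π * Complex.I))⁻¹ - (complexMGF id μ (u + π * Complex.I))⁻¹ =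
      2 * Complex.I * expH μ u := by
  have h1 : complexMGF id μ (u - π * Complex.I) ≠ 0 :=
    complexMGF_ne_zero hμ hs (by simp [abs_of_pos pi_pos])
  have h2 : complexMGF id μ (u + π * Complex.I) ≠ 0 :=
    complexMGF_ne_zero hμ hs (by simp [abs_of_pos pi_pos])
  rw [complexMGF_sub_pi_mul_I hs] at h1 ⊢
  rw [complexMGF_add_pi_mul_I hs] at h2 ⊢
  have h3 : ((expSin μ u : ℂ) ^ 2 + (expCos μ u : ℂ) ^ 2) ≠ 0 := by
    exact_mod_cast (expH_denom_pos hμ hs u).ne'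
  rw [expH]
  push_cast
  rw [inv_sub_inv h1 h2, div_eq_iff (mul_ne_zero h1 h2)]
  field_simp
  ring_nf
  simp only [show Complex.I ^ 3 = -Complex.I by
    rw [pow_succ, Complex.I_sq]; ring]
  ring

lemma exp_ne_exp_ofReal {z : ℂ} {x : ℝ} (hz : |z.im| ≤ π) (hzx : z ≠ x) :
    Complex.exp z ≠ Complex.exp x := by
  intro h
  apply hzx
  obtain ⟨n, hn⟩ := Complex.exp_eq_exp_iff_exists_int.1 h
  have him : z.im = n * (2 * π) := by rw [hn]; simp
  have : n = 0 := by
    rw [him, abs_mul, abs_of_pos (by positivity : 0 < 2 * π)] at hz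
    have h1 : |(n : ℝ)| < 1 := by nlinarith [pi_pos, abs_nonneg (n : ℝ)]
    exact Int.abs_lt_one_iff.1 (by exact_mod_cast h1)
  simpa [this] using hn

/-- The integrand of the contour argument, with its singularity at `x` removed. -/
noncomputable def contourFun (μ : Measure ℝ) (x : ℝ) (z : ℂ) : ℂ :=
  dslope (fun z => (complexMGF id μ z)⁻¹) x z * Complex.exp z / dslope Complex.exp x z

omit [IsFiniteMeasure μ] in
lemma contourFun_of_ne {x : ℝ} {z : ℂ} (hzx : z ≠ x) :
    contourFun μ x z = ((complexMGF id μ z)⁻¹ - (complexMGF id μ x)⁻¹) *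
      (Complex.exp z / (Complex.exp z - Complex.exp x)) := by
  have : z - x ≠ 0 := sub_ne_zero.2 hzx
  rw [contourFun, dslope_of_ne _ hzx, dslope_of_ne _ hzx, slope_def_field, slope_def_field]
  rw [div_mul_eq_mul_div, div_div_div_cancel_right₀ this, mul_div_assoc]

lemma differentiableOn_contourFun (hμ : μ ≠ 0) (hs : ∀ᵐ a ∂μ, a ∈ Set.Ioo (0 : ℝ) 1) (x : ℝ) :
    DifferentiableOn ℂ (contourFun μ x) {z | |z.im| ≤ π} := by
  have hE := differentiable_complexMGF hs
  have hopen : IsOpen {z | complexMGF id μ z ≠ 0} := isOpen_ne_fun hE.continuous continuous_const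
  have h1 : DifferentiableOn ℂ (dslope (fun z => (complexMGF id μ z)⁻¹) x)
      {z | complexMGF id μ z ≠ 0} :=
    (Complex.differentiableOn_dslope
      (hopen.mem_nhds (complexMGF_ne_zero hμ hs (by simp [pi_pos.le])))).2
      fun z hz => (hE z).differentiableWithinAt.inv hz
  have h2 : Differentiable ℂ (dslope Complex.exp x) := by
    rw [← differentiableOn_univ]
    exact (Complex.differentiableOn_dslope univ_mem).2
      Complex.differentiable_exp.differentiableOn
  refine ((h1.mono fun z hz => complexMGF_ne_zero hμ hs hz).mul
    Complex.differentiable_exp.differentiableOn).div h2.differentiableOn fun z hz => ?_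
  by_cases hzx : z = x
  · subst hzx
    rw [dslope_same, Complex.deriv_exp]
    exact Complex.exp_ne_zero _
  · rw [dslope_of_ne _ hzx, slope_def_field]
    exact div_ne_zero (sub_ne_zero.2 (exp_ne_exp_ofReal hz hzx)) (sub_ne_zero.2 hzx)

lemma contourFun_jump (hμ : μ ≠ 0) (hs : ∀ᵐ a ∂μ, a ∈ Set.Ioo (0 : ℝ) 1) (x u : ℝ) :
    contourFun μ x (u - π * Complex.I) - contourFun μ x (u + π * Complex.I) =
      2 * Complex.I * ((expH μ u * (exp u / (exp u + exp x)) : ℝ) : ℂ) := by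
  have hne (ε : ℝ) (hε : ε ≠ 0) : ((u : ℂ) + ε * Complex.I) ≠ x := fun h => hε (by
    simpa using congrArg Complex.im h)
  have h1 := hne π pi_pos.ne'
  have h2 : ((u : ℂ) - π * Complex.I) ≠ x := by
    simpa [sub_eq_add_neg] using hne (-π) (by simp [pi_pos.ne'])
  rw [contourFun_of_ne h1, contourFun_of_ne h2, Complex.exp_add, Complex.exp_sub,
    Complex.exp_pi_mul_I]
  have h3 : Complex.exp u * -1 / (Complex.exp u * -1 - Complex.exp x) =
      Complex.exp u / (Complex.exp u + Complex.exp x) := by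
    rw [← neg_div_neg_eq]; congr 1 <;> ring
  rw [div_neg, div_one, ← mul_neg_one, h3, ← sub_mul, sub_sub_sub_cancel_right,
    inv_complexMGF_jump hμ hs]
  push_cast
  ring

lemma norm_inv_complexMGF_le (hμ : μ ≠ 0) (hs : ∀ᵐ a ∂μ, a ∈ Set.Ioo (0 : ℝ) 1) (u : ℝ) {θ : ℝ}
    (hθ : |θ| ≤ π) : ‖(complexMGF id μ (u + θ * Complex.I))⁻¹‖ ≤ (expSin μ u)⁻¹ := by
  rw [norm_inv]
  exact inv_anti₀ (expSin_pos hμ hs u) (expSin_le_norm_complexMGF hs u hθ)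

lemma norm_exp_add_mul_I (u θ : ℝ) : ‖Complex.exp (u + θ * Complex.I)‖ = exp u := by
  rw [Complex.norm_exp]; simp

lemma abs_le_pi_of_mem_uIoc {y : ℝ} (hy : y ∈ Set.uIoc (-π) π) : |y| ≤ π := by
  rw [Set.uIoc_of_le (by linarith [pi_pos])] at hy
  exact abs_le.2 ⟨hy.1.le, hy.2⟩

lemma tendsto_contour_left (hμ : μ ≠ 0) (hs : ∀ᵐ a ∂μ, a ∈ Set.Ioo (0 : ℝ) 1) (x : ℝ) :
    Tendsto (fun R : ℝ => ∫ y in (-π)..π, contourFun μ x ((-R : ℝ) + y * Complex.I)) atTop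
      (𝓝 0) := by
  set g := ‖(complexMGF id μ x)⁻¹‖
  have hb : ∀ᶠ R : ℝ in atTop, ‖∫ y in (-π)..π, contourFun μ x ((-R : ℝ) + y * Complex.I)‖ ≤
      ((exp R * expSin μ (-R))⁻¹ + g * exp (-R)) / (exp x - exp (-R)) * |π - -π| := by
    filter_upwards [eventually_gt_atTop (-x)] with R hR
    refine intervalIntegral.norm_integral_le_of_norm_le_const fun y hy => ?_
    have hθ := abs_le_pi_of_mem_uIoc hy
    have hlt : exp (-R) < exp x := exp_lt_exp.2 (by linarith)
    have hne : (((-R : ℝ) : ℂ) + y * Complex.I) ≠ x := fun h => by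
      have := congrArg Complex.re h
      simp at this
      linarith
    rw [contourFun_of_ne hne, norm_mul, norm_div, norm_exp_add_mul_I]
    have h1 : ‖(complexMGF id μ ((-R : ℝ) + y * Complex.I))⁻¹ - (complexMGF id μ x)⁻¹‖ ≤
        (expSin μ (-R))⁻¹ + g :=
      (norm_sub_le _ _).trans (by gcongr; exact norm_inv_complexMGF_le hμ hs _ hθ)
    have h2 : exp x - exp (-R) ≤
        ‖Complex.exp ((-R : ℝ) + y * Complex.I) - Complex.exp x‖ := by
      have := norm_sub_norm_le (Complex.exp x) (Complex.exp ((-R : ℝ) + y * Complex.I))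
      rw [norm_exp_add_mul_I, Complex.norm_exp_ofReal, norm_sub_rev] at this
      exact this
    have hS := expSin_pos hμ hs (-R)
    calc _ ≤ ((expSin μ (-R))⁻¹ + g) * (exp (-R) / (exp x - exp (-R))) := by
          have := sub_pos.2 hlt
          gcongr
      _ = _ := by rw [exp_neg, mul_inv]; ring
  refine squeeze_zero_norm' hb ?_
  have e1 : Tendsto (fun R : ℝ => exp (-R)) atTop (𝓝 0) := tendsto_exp_neg_atTop_nhds_zero
  have e2 := (tendsto_exp_mul_expSin_neg_atTop hμ hs).inv_tendsto_atTop
  have := ((e2.add (e1.const_mul g)).div (e1.const_sub (exp x))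
    (by simp [exp_ne_zero])).mul_const |π - -π|
  simpa using this

lemma intervalIntegrable_contourFun_vertical (hμ : μ ≠ 0) (hs : ∀ᵐ a ∂μ, a ∈ Set.Ioo (0 : ℝ) 1)
    (x R : ℝ) :
    IntervalIntegrable (fun y : ℝ => contourFun μ x (R + y * Complex.I)) volume (-π) π := by
  refine ContinuousOn.intervalIntegrable ?_
  refine (differentiableOn_contourFun hμ hs x).continuousOn.comp (by fun_prop) fun y hy => ?_
  rw [Set.uIcc_of_le (by linarith [pi_pos])] at hy
  simpa using abs_le.2 hy

lemma tendsto_contour_right (hμ : μ ≠ 0) (hs : ∀ᵐ a ∂μ, a ∈ Set.Ioo (0 : ℝ) 1) (x : ℝ) :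
    Tendsto (fun R : ℝ => ∫ y in (-π)..π, contourFun μ x (R + y * Complex.I)) atTop
      (𝓝 (-(2 * π * (complexMGF id μ x)⁻¹))) := by
  set g := (complexMGF id μ x)⁻¹ with hg
  have hb : ∀ᶠ R : ℝ in atTop,
      ‖(∫ y in (-π)..π, contourFun μ x (R + y * Complex.I)) + 2 * π * g‖ ≤
      ((expSin μ R)⁻¹ * (1 + exp x / (exp R - exp x)) + ‖g‖ * (exp x / (exp R - exp x))) *
        |π - -π| := by
    filter_upwards [eventually_gt_atTop x] with R hR
    have hc : (2 * π * g : ℂ) = ∫ y in (-π)..π, g := by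
      rw [intervalIntegral.integral_const, Complex.real_smul]; push_cast; ring
    rw [hc, ← intervalIntegral.integral_add (intervalIntegrable_contourFun_vertical hμ hs x R)
      (by simp)]
    refine intervalIntegral.norm_integral_le_of_norm_le_const fun y hy => ?_
    have hθ := abs_le_pi_of_mem_uIoc hy
    have hlt : exp x < exp R := exp_lt_exp.2 hR
    have hne : ((R : ℂ) + y * Complex.I) ≠ x := fun h => by
      have := congrArg Complex.re h
      simp at this
      linarith
    have h2 : exp R - exp x ≤ ‖Complex.exp (R + y * Complex.I) - Complex.exp x‖ := by
      have := norm_sub_norm_le (Complex.exp (R + y * Complex.I)) (Complex.exp x)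
      rwa [norm_exp_add_mul_I, Complex.norm_exp_ofReal] at this
    have hpos := sub_pos.2 hlt
    have hsub : Complex.exp (R + y * Complex.I) - Complex.exp x ≠ 0 :=
      norm_pos_iff.1 (hpos.trans_le h2)
    set q := Complex.exp x / (Complex.exp (R + y * Complex.I) - Complex.exp x) with hq
    have hq' : ‖q‖ ≤ exp x / (exp R - exp x) := by
      rw [hq, norm_div, Complex.norm_exp_ofReal]
      gcongr
    have hS := expSin_pos hμ hs R
    have e : contourFun μ x (R + y * Complex.I) + g =
        (complexMGF id μ (R + y * Complex.I))⁻¹ * (1 + q) - g * q := by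
      rw [contourFun_of_ne hne, ← hg, hq]
      field_simp
      ring
    rw [e]
    refine (norm_sub_le _ _).trans ?_
    rw [norm_mul, norm_mul]
    have h3 : ‖1 + q‖ ≤ 1 + exp x / (exp R - exp x) :=
      (norm_add_le _ _).trans (by rw [norm_one]; gcongr)
    gcongr
    exact norm_inv_complexMGF_le hμ hs _ hθ
  rw [tendsto_iff_norm_sub_tendsto_zero]
  simp only [sub_neg_eq_add]
  refine squeeze_zero' (Eventually.of_forall fun _ => norm_nonneg _) hb ?_
  have e1 : Tendsto (fun R : ℝ => exp x / (exp R - exp x)) atTop (𝓝 0) :=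
    tendsto_const_nhds.div_atTop (tendsto_atTop_add_const_right _ _ tendsto_exp_atTop)
  have e2 := (tendsto_expSin_atTop hμ hs).inv_tendsto_atTop
  have := ((e2.mul (e1.const_add 1)).add (e1.const_mul ‖g‖)).mul_const |π - -π|
  simpa using this

lemma contour_identity (hμ : μ ≠ 0) (hs : ∀ᵐ a ∂μ, a ∈ Set.Ioo (0 : ℝ) 1) (x R : ℝ) :
    ((∫ u in (-R)..R, expH μ u * (exp u / (exp u + exp x)) : ℝ) : ℂ) =
      (1 / 2) * ((∫ y in (-π)..π, contourFun μ x ((-R : ℝ) + y * Complex.I)) -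
        ∫ y in (-π)..π, contourFun μ x (R + y * Complex.I)) := by
  have hd := differentiableOn_contourFun hμ hs x
  have hrect := Complex.integral_boundary_rect_eq_zero_of_differentiableOn (contourFun μ x)
    ⟨-R, -π⟩ ⟨R, π⟩ (hd.mono fun z hz => by
      have h := (Complex.mem_reProdIm.1 hz).2
      rw [Set.uIcc_of_le (by linarith [pi_pos])] at h
      exact abs_le.2 h)
  simp only [smul_eq_mul] at hrect
  have hint (θ : ℝ) (hθ : |θ| ≤ π) :
      IntervalIntegrable (fun u : ℝ => contourFun μ x (u + θ * Complex.I)) volume (-R) R := by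
    refine ContinuousOn.intervalIntegrable ?_
    exact hd.continuousOn.comp (by fun_prop) fun y hy => by simpa using hθ
  rw [← intervalIntegral.integral_sub (hint (-π) (by simp [abs_of_pos pi_pos]))
    (hint π (by simp [abs_of_pos pi_pos]))] at hrect
  have hj : (fun u : ℝ => contourFun μ x (u + ((-π : ℝ) : ℂ) * Complex.I) -
      contourFun μ x (u + (π : ℂ) * Complex.I)) = fun u : ℝ =>
      2 * Complex.I * ((expH μ u * (exp u / (exp u + exp x)) : ℝ) : ℂ) := by
    ext u
    rw [← contourFun_jump hμ hs x u]
    simp [sub_eq_add_neg]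
  rw [hj, intervalIntegral.integral_const_mul, intervalIntegral.integral_ofReal] at hrect
  have hI := Complex.I_ne_zero
  apply mul_left_cancel₀ (mul_ne_zero two_ne_zero hI)
  linear_combination hrect

lemma tendsto_integral_expH (hμ : μ ≠ 0) (hs : ∀ᵐ a ∂μ, a ∈ Set.Ioo (0 : ℝ) 1) (x : ℝ) :
    Tendsto (fun R : ℝ => ∫ u in (-R)..R, expH μ u * (exp u / (exp u + exp x))) atTop
      (𝓝 (π * (mgf id μ x)⁻¹)) := by
  rw [← Filter.tendsto_ofReal_iff]
  simp only [contour_identity hμ hs]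
  convert ((tendsto_contour_left hμ hs x).sub (tendsto_contour_right hμ hs x)).const_mul
    (1 / 2 : ℂ) using 2
  rw [complexMGF_ofReal]
  push_cast
  ring

lemma lintegral_expH (hμ : μ ≠ 0) (hs : ∀ᵐ a ∂μ, a ∈ Set.Ioo (0 : ℝ) 1) (x : ℝ) :
    ∫⁻ u, ENNReal.ofReal (expH μ u * (exp u / (exp u + exp x))) =
      ENNReal.ofReal (π * (mgf id μ x)⁻¹) := by
  have hc : Continuous fun u => expH μ u * (exp u / (exp u + exp x)) :=
    (continuous_expH hμ hs).mul (continuous_exp.div (by fun_prop) fun u => by positivity)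
  have hnn (u : ℝ) : 0 ≤ expH μ u * (exp u / (exp u + exp x)) :=
    mul_nonneg (expH_nonneg hμ hs u) (by positivity)
  refine (aecover_Ioc tendsto_neg_atTop_atBot tendsto_id).lintegral_eq_of_tendsto _
    hc.measurable.ennreal_ofReal.aemeasurable ?_
  refine (ENNReal.tendsto_ofReal (tendsto_integral_expH hμ hs x)).congr' ?_
  filter_upwards [eventually_ge_atTop 0] with R hR
  rw [intervalIntegral.integral_of_le (by linarith)]
  exact ofReal_integral_eq_lintegral_ofReal (hc.integrableOn_Ioc) (ae_of_all _ hnn)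

end Contour

section Laplace

lemma ext_of_lintegral_exp {A B : Measure ℝ}
    (h : ∀ z > 0, ∫⁻ x, ENNReal.ofReal (exp (-(z * x))) ∂A =
      ∫⁻ x, ENNReal.ofReal (exp (-(z * x))) ∂B)
    (hfin : ∀ z > 0, ∫⁻ x, ENNReal.ofReal (exp (-(z * x))) ∂A ≠ ⊤) : A = B := by
  have hset (C : Measure ℝ) (hC : ∀ z > 0, ∫⁻ x, ENNReal.ofReal (exp (-(z * x))) ∂C ≠ ⊤) :
      Set.Iio (0 : ℝ) ⊆ interior (integrableExpSet id C) := by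
    refine interior_maximal (fun t ht => ?_) isOpen_Iio
    refine (lintegral_ofReal_ne_top_iff_integrable (by fun_prop) (ae_of_all _ fun x => ?_)).1 ?_
    · exact (exp_pos _).le
    · simpa using hC (-t) (neg_pos.2 ht)
  have hA := hset A hfin
  have hB := hset B fun z hz => h z hz ▸ hfin z hz
  have hmgf (t : ℝ) (ht : t < 0) : mgf id A t = mgf id B t := by
    rw [mgf, mgf, integral_eq_lintegral_of_nonneg_ae (ae_of_all _ fun x => (exp_pos _).le)
      (by fun_prop), integral_eq_lintegral_of_nonneg_ae (ae_of_all _ fun x => (exp_pos _).le)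
      (by fun_prop)]
    simpa using congrArg ENNReal.toReal (h (-t) (neg_pos.2 ht))
  have hcomplex : Set.EqOn (complexMGF id A) (complexMGF id B) {z | z.re < 0} := by
    refine AnalyticOnNhd.eqOn_of_preconnected_of_frequently_eq
      (analyticOnNhd_complexMGF.mono fun z hz => hA hz)
      (analyticOnNhd_complexMGF.mono fun z hz => hB hz)
      (convex_halfSpace_re_lt 0).isPreconnected (z₀ := ((-1 : ℝ) : ℂ)) (by simp) ?_
    have h_real : ∃ᶠ x : ℝ in 𝓝[≠] (-1), complexMGF id A x = complexMGF id B x := by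
      refine Eventually.frequently (eventually_nhdsWithin_of_eventually_nhds ?_)
      filter_upwards [eventually_lt_nhds (show (-1 : ℝ) < 0 by norm_num)] with y hy
      rw [complexMGF_ofReal, complexMGF_ofReal, hmgf y hy]
    refine Tendsto.frequently (f := fun x : ℝ => (x : ℂ)) ?_ h_real
    refine tendsto_nhdsWithin_iff.2 ⟨?_, ?_⟩
    · exact (Complex.continuous_ofReal.tendsto _).mono_left nhdsWithin_le_nhds
    · filter_upwards [self_mem_nhdsWithin] with y hy
      exact Complex.ofReal_injective.ne hy
  set f : ℝ → ENNReal := fun x => ENNReal.ofReal (exp (-x)) with hf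
  have hfm : Measurable f := by fun_prop
  have hchar (C : Measure ℝ) (t : ℝ) :
      charFun (C.withDensity f) t = complexMGF id C (-1 + t * Complex.I) := by
    rw [charFun_apply_real, integral_withDensity_eq_integral_toReal_smul hfm
      (ae_of_all _ fun x => ENNReal.ofReal_lt_top), complexMGF]
    congr 1 with x
    rw [ENNReal.toReal_ofReal (exp_pos _).le, Complex.real_smul, Complex.ofReal_exp,
      ← Complex.exp_add]
    congr 1
    simp
    ring
  have key : A.withDensity f = B.withDensity f := by
    have := isFiniteMeasure_withDensity (μ := A) (f := f) (by simpa using hfin 1 one_pos)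
    have := isFiniteMeasure_withDensity (μ := B) (f := f)
      (by have := hfin 1 one_pos; rw [h 1 one_pos] at this; simpa using this)
    refine Measure.ext_of_charFun (funext fun t => ?_)
    rw [hchar, hchar]
    exact hcomplex (by simp)
  have hinv (C : Measure ℝ) : (C.withDensity f).withDensity f⁻¹ = C :=
    withDensity_inv_same hfm (ae_of_all _ fun x => by simp [hf, exp_pos])
      (ae_of_all _ fun x => ENNReal.ofReal_ne_top)
  rw [← hinv A, key, hinv]

lemma lintegral_rpow_mul_exp_neg_mul_Ioi {a z : ℝ} (ha : 0 < a) (hz : 0 < z) :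
    ∫⁻ t in Set.Ioi (0 : ℝ), ENNReal.ofReal (t ^ (a - 1) * exp (-(z * t))) =
      ENNReal.ofReal ((1 / z) ^ a * Gamma a) := by
  have h := integral_rpow_mul_exp_neg_mul_Ioi ha hz
  have hpos : 0 < (1 / z) ^ a * Gamma a := mul_pos (by positivity) (Gamma_pos_of_pos ha)
  rw [← h, ofReal_integral_eq_lintegral_ofReal (.of_integral_ne_zero (by rw [h]; exact hpos.ne'))]
  filter_upwards [ae_restrict_mem measurableSet_Ioi] with t ht
  have : (0 : ℝ) < t := ht
  positivity

lemma lintegral_exp_neg_mul_Ioi {z : ℝ} (hz : 0 < z) :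
    ∫⁻ t in Set.Ioi (0 : ℝ), ENNReal.ofReal (exp (-(z * t))) = ENNReal.ofReal (1 / z) := by
  simpa using lintegral_rpow_mul_exp_neg_mul_Ioi one_pos hz

lemma lintegral_exp_neg_conv (A B : Measure ℝ) [SFinite B] (z : ℝ) :
    ∫⁻ x, ENNReal.ofReal (exp (-(z * x))) ∂(A.conv B) =
      (∫⁻ x, ENNReal.ofReal (exp (-(z * x))) ∂A) *
        ∫⁻ x, ENNReal.ofReal (exp (-(z * x))) ∂B := by
  rw [Measure.lintegral_conv (by fun_prop), ← lintegral_mul_const _ (by fun_prop)]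
  refine lintegral_congr fun x => ?_
  rw [← lintegral_const_mul _ (by fun_prop)]
  refine lintegral_congr fun y => ?_
  rw [← ENNReal.ofReal_mul (exp_pos _).le, ← exp_add]
  congr 2
  ring

/-- The Laplace transform of a measure, with values in `[0,∞]`. -/
noncomputable def lintegralExp (ρ : Measure ℝ) (t : ℝ) : ENNReal :=
  ∫⁻ r, ENNReal.ofReal (exp (-(r * t))) ∂ρ

lemma measurable_lintegralExp (ρ : Measure ℝ) [SFinite ρ] : Measurable (lintegralExp ρ) :=
  Measurable.lintegral_prod_right' (f := fun p : ℝ × ℝ => ENNReal.ofReal (exp (-(p.2 * p.1))))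
    (by fun_prop)

lemma lintegralExp_antitone {ρ : Measure ℝ} (hρ : ∀ᵐ r ∂ρ, 0 < r) :
    Antitone (lintegralExp ρ) := fun s t hst => lintegral_mono_ae <| by
  filter_upwards [hρ] with r hr
  gcongr

lemma lintegral_exp_mul_lintegralExp {ρ : Measure ℝ} [SFinite ρ] (hρ : ∀ᵐ r ∂ρ, 0 < r)
    {z : ℝ} (hz : 0 < z) :
    ∫⁻ t in Set.Ioi (0 : ℝ), lintegralExp ρ t * ENNReal.ofReal (exp (-(z * t))) =
      ∫⁻ r, ENNReal.ofReal (1 / (r + z)) ∂ρ := by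
  simp only [lintegralExp]
  have (t : ℝ) : (∫⁻ r, ENNReal.ofReal (exp (-(r * t))) ∂ρ) * ENNReal.ofReal (exp (-(z * t))) =
      ∫⁻ r, ENNReal.ofReal (exp (-((r + z) * t))) ∂ρ := by
    rw [← lintegral_mul_const _ (by fun_prop)]
    refine lintegral_congr fun r => ?_
    rw [← ENNReal.ofReal_mul (exp_pos _).le, ← exp_add]
    congr 2
    ring
  simp only [this]
  rw [lintegral_lintegral_swap (by fun_prop)]
  refine lintegral_congr_ae ?_
  filter_upwards [hρ] with r hr
  exact lintegral_exp_neg_mul_Ioi (by positivity)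

lemma lintegralExp_ne_top {ρ : Measure ℝ} (hρ : ∀ᵐ r ∂ρ, 0 < r) {t : ℝ} (ht : 0 < t)
    (hfin : ∫⁻ r, ENNReal.ofReal (1 / (r + t⁻¹)) ∂ρ ≠ ⊤) : lintegralExp ρ t ≠ ⊤ := by
  have h : ∫⁻ r, ENNReal.ofReal (t⁻¹) * ENNReal.ofReal (1 / (r + t⁻¹)) ∂ρ ≠ ⊤ := by
    rw [lintegral_const_mul _ (by fun_prop)]
    exact ENNReal.mul_ne_top ENNReal.ofReal_ne_top hfin
  refine ne_top_of_le_ne_top h (lintegral_mono_ae ?_)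
  filter_upwards [hρ] with r hr
  rw [← ENNReal.ofReal_mul (by positivity)]
  refine ENNReal.ofReal_le_ofReal ?_
  rw [exp_neg]
  have e : t⁻¹ * (1 / (r + t⁻¹)) = (r * t + 1)⁻¹ := by field_simp
  rw [e]
  exact inv_anti₀ (by positivity) (add_one_le_exp _)

end Laplace

section Kernels

variable {μ : Measure ℝ} [IsFiniteMeasure μ]

/-- The measure `π⁻¹ H(r) dr` on `(0,∞)`, whose Laplace transform is `lker μ`. -/
noncomputable def spectralMeasure (μ : Measure ℝ) : Measure ℝ :=
  (volume.restrict (Set.Ioi 0)).withDensity fun r => ENNReal.ofReal (π⁻¹ * expH μ (log r))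

omit [IsFiniteMeasure μ] in
lemma ae_pos_spectralMeasure : ∀ᵐ r ∂spectralMeasure μ, 0 < r :=
  (withDensity_absolutelyContinuous _ _).ae_le (ae_restrict_mem measurableSet_Ioi)

lemma measurable_expH_log (hμ : μ ≠ 0) (hs : ∀ᵐ a ∂μ, a ∈ Set.Ioo (0 : ℝ) 1) :
    Measurable fun r => π⁻¹ * expH μ (log r) :=
  ((continuous_expH hμ hs).measurable.comp measurable_log).const_mul _

lemma lintegral_spectralMeasure (hμ : μ ≠ 0) (hs : ∀ᵐ a ∂μ, a ∈ Set.Ioo (0 : ℝ) 1) {z : ℝ}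
    (hz : 0 < z) :
    ∫⁻ r, ENNReal.ofReal (1 / (r + z)) ∂spectralMeasure μ =
      ENNReal.ofReal (mgf id μ (log z))⁻¹ := by
  rw [spectralMeasure, lintegral_withDensity_eq_lintegral_mul _
    (measurable_expH_log hμ hs).ennreal_ofReal (by fun_prop), ← range_exp, ← Set.image_univ,
    lintegral_image_eq_lintegral_abs_deriv_mul MeasurableSet.univ
      (fun x _ => (hasDerivAt_exp x).hasDerivWithinAt) exp_injective.injOn, Measure.restrict_univ]
  have h := lintegral_expH hμ hs (log z)
  rw [exp_log hz] at h
  have e (u : ℝ) : ENNReal.ofReal |exp u| * ((fun r => ENNReal.ofReal (π⁻¹ * expH μ (log r))) *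
      fun r => ENNReal.ofReal (1 / (r + z))) (exp u) =
      ENNReal.ofReal π⁻¹ * ENNReal.ofReal (expH μ u * (exp u / (exp u + z))) := by
    have := expH_nonneg hμ hs u
    rw [Pi.mul_apply, log_exp, abs_of_pos (exp_pos u), ← ENNReal.ofReal_mul (by positivity),
      ← ENNReal.ofReal_mul (by positivity), ← ENNReal.ofReal_mul (by positivity)]
    congr 1
    ring
  simp only [e]
  rw [lintegral_const_mul' _ _ ENNReal.ofReal_ne_top, h, ← ENNReal.ofReal_mul (by positivity),
    inv_mul_cancel_left₀ pi_ne_zero]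

lemma lintegralExp_spectralMeasure_ne_top (hμ : μ ≠ 0) (hs : ∀ᵐ a ∂μ, a ∈ Set.Ioo (0 : ℝ) 1)
    {t : ℝ} (ht : 0 < t) : lintegralExp (spectralMeasure μ) t ≠ ⊤ := by
  refine lintegralExp_ne_top ae_pos_spectralMeasure ht ?_
  rw [lintegral_spectralMeasure hμ hs (inv_pos.2 ht)]
  exact ENNReal.ofReal_ne_top

omit [IsFiniteMeasure μ] in
lemma Hker_eq_expH (hs : ∀ᵐ a ∂μ, a ∈ Set.Ioo (0 : ℝ) 1) {r : ℝ} (hr : 0 < r) :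
    Hker μ r = expH μ (log r) := by
  have hres : μ.restrict (Set.Ioc 0 1) = μ :=
    Measure.restrict_eq_self_of_ae_mem (hs.mono fun _ ha => Set.Ioo_subset_Ioc_self ha)
  simp only [Hker, expH, expSin, expCos, hres, rpow_def_of_pos hr]

lemma lker_eq_mgf (hμ : μ ≠ 0) (hs : ∀ᵐ a ∂μ, a ∈ Set.Ioo (0 : ℝ) 1) :
    lker μ = mgf (fun r => -r) (spectralMeasure μ) := by
  ext t
  rw [lker, ← integral_const_mul, mgf, spectralMeasure,
    integral_withDensity_eq_integral_toReal_smul (measurable_expH_log hμ hs).ennreal_ofReal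
      (ae_of_all _ fun _ => ENNReal.ofReal_lt_top)]
  refine setIntegral_congr_fun measurableSet_Ioi fun r hr => ?_
  have := expH_nonneg hμ hs (log r)
  rw [ENNReal.toReal_ofReal (by positivity), Hker_eq_expH hs hr, smul_eq_mul]
  ring_nf

lemma integrable_exp_neg_spectralMeasure (hμ : μ ≠ 0)
    (hs : ∀ᵐ a ∂μ, a ∈ Set.Ioo (0 : ℝ) 1) {t : ℝ} (ht : 0 < t) :
    Integrable (fun r => exp (t * -r)) (spectralMeasure μ) := by
  refine (lintegral_ofReal_ne_top_iff_integrable (by fun_prop)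
    (ae_of_all _ fun r => (exp_pos _).le)).1 ?_
  simpa [lintegralExp, mul_comm] using lintegralExp_spectralMeasure_ne_top hμ hs ht

lemma ofReal_lker (hμ : μ ≠ 0) (hs : ∀ᵐ a ∂μ, a ∈ Set.Ioo (0 : ℝ) 1) {t : ℝ} (ht : 0 < t) :
    ENNReal.ofReal (lker μ t) = lintegralExp (spectralMeasure μ) t := by
  rw [lker_eq_mgf hμ hs, mgf, ofReal_integral_eq_lintegral_ofReal
    (integrable_exp_neg_spectralMeasure hμ hs ht) (ae_of_all _ fun r => (exp_pos _).le)]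
  simp [lintegralExp, mul_comm]

lemma contDiffOn_lker (hμ : μ ≠ 0) (hs : ∀ᵐ a ∂μ, a ∈ Set.Ioo (0 : ℝ) 1) :
    ContDiffOn ℝ (⊤ : ℕ∞) (lker μ) (Set.Ioi 0) := by
  rw [lker_eq_mgf hμ hs]
  have h : Set.Ioi (0 : ℝ) ⊆ interior (integrableExpSet (fun r => -r) (spectralMeasure μ)) :=
    interior_maximal (fun t ht => integrable_exp_neg_spectralMeasure hμ hs ht) isOpen_Ioi
  exact (analyticOnNhd_mgf.mono h).contDiffOn (uniqueDiffOn_Ioi 0)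

/-- The kernel `k` with values in `[0,∞]`. -/
noncomputable def kdens (μ : Measure ℝ) (s : ℝ) : ENNReal :=
  ∫⁻ a, ENNReal.ofReal (s ^ (-a) * (Gamma (1 - a))⁻¹) ∂μ

lemma measurable_inv_Gamma : Measurable fun a : ℝ => (Gamma a)⁻¹ := by
  have h : (fun a : ℝ => (Gamma a)⁻¹) = fun a : ℝ => ((Complex.Gamma a)⁻¹).re := by
    ext a
    rw [Complex.Gamma_ofReal, ← Complex.ofReal_inv, Complex.ofReal_re]
  rw [h]
  exact (Complex.continuous_re.comp
    (Complex.differentiable_one_div_Gamma.continuous.comp Complex.continuous_ofReal)).measurable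

lemma measurable_kdens_integrand :
    Measurable fun p : ℝ × ℝ => ENNReal.ofReal (p.1 ^ (-p.2) * (Gamma (1 - p.2))⁻¹) := by
  have := measurable_inv_Gamma.comp (measurable_const.sub measurable_snd :
    Measurable fun p : ℝ × ℝ => 1 - p.2)
  exact ((measurable_fst.pow measurable_snd.neg).mul this).ennreal_ofReal

lemma measurable_kdens : Measurable (kdens μ) :=
  measurable_kdens_integrand.lintegral_prod_right'

lemma lintegral_exp_mul_kdens (hs : ∀ᵐ a ∂μ, a ∈ Set.Ioo (0 : ℝ) 1) {z : ℝ} (hz : 0 < z) :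
    ∫⁻ t in Set.Ioi (0 : ℝ), kdens μ t * ENNReal.ofReal (exp (-(z * t))) =
      ENNReal.ofReal (z⁻¹ * mgf id μ (log z)) := by
  have hm : Measurable fun p : ℝ × ℝ => ENNReal.ofReal (p.1 ^ (-p.2) * (Gamma (1 - p.2))⁻¹) *
      ENNReal.ofReal (exp (-(z * p.1))) := measurable_kdens_integrand.mul (by fun_prop)
  simp only [kdens]
  have (t : ℝ) := lintegral_mul_const (μ := μ) (ENNReal.ofReal (exp (-(z * t))))
    (measurable_kdens_integrand.comp (measurable_prodMk_left (x := t)))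
  simp only [Function.comp_def] at this
  simp only [← this]
  rw [lintegral_lintegral_swap hm.aemeasurable, mgf, ← integral_const_mul,
    ofReal_integral_eq_lintegral_ofReal (integrable_of_continuousOn_of_ae_mem_Ioo hs
      (by simp only [id]; fun_prop)) (ae_of_all _ fun a => by positivity)]
  refine lintegral_congr_ae ?_
  filter_upwards [hs] with a ha
  have ha1 : 0 < 1 - a := by linarith [ha.2]
  have hΓ := Gamma_pos_of_pos ha1
  have e : ∀ t ∈ Set.Ioi (0 : ℝ), ENNReal.ofReal (t ^ (-a) * (Gamma (1 - a))⁻¹) *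
      ENNReal.ofReal (exp (-(z * t))) = ENNReal.ofReal (Gamma (1 - a))⁻¹ *
        ENNReal.ofReal (t ^ ((1 - a) - 1) * exp (-(z * t))) := fun t ht => by
    have : (0 : ℝ) < t := ht
    rw [← ENNReal.ofReal_mul (by positivity), ← ENNReal.ofReal_mul (by positivity),
      show 1 - a - 1 = -a by ring]
    congr 1
    ring
  rw [setLIntegral_congr_fun measurableSet_Ioi e, lintegral_const_mul' _ _ ENNReal.ofReal_ne_top,
    lintegral_rpow_mul_exp_neg_mul_Ioi ha1 hz, ← ENNReal.ofReal_mul (by positivity)]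
  congr 1
  rw [mul_comm ((1 / z) ^ (1 - a)), inv_mul_cancel_left₀ hΓ.ne', one_div, inv_rpow hz.le,
    ← rpow_neg hz.le, id, ← rpow_def_of_pos hz, ← rpow_neg_one, ← rpow_add hz]
  ring_nf

lemma ofReal_rpow_le_setLIntegral {t a : ℝ} (ht : 0 < t) (ha : a ∈ Set.Ioo (0 : ℝ) 1) :
    ENNReal.ofReal (t ^ (1 - a)) ≤
      ∫⁻ s in Set.Ioo 0 t, ENNReal.ofReal (s ^ (-a) * (Gamma (1 - a))⁻¹) := by
  have ha1 : 0 < 1 - a := by linarith [ha.2]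
  have hΓ := Gamma_pos_of_pos ha1
  have hint : IntegrableOn (fun s => s ^ (-a) * (Gamma (1 - a))⁻¹) (Set.Ioo 0 t) :=
    (((intervalIntegral.intervalIntegrable_rpow' (by linarith [ha.2])).mul_const _).1).mono_set
      Set.Ioo_subset_Ioc_self
  rw [← ofReal_integral_eq_lintegral_ofReal hint ?_]
  · refine ENNReal.ofReal_le_ofReal ?_
    rw [← integral_Ioc_eq_integral_Ioo, ← intervalIntegral.integral_of_le ht.le,
      intervalIntegral.integral_mul_const, integral_rpow (Or.inl (by linarith [ha.2])),
      show -a + 1 = 1 - a by ring, zero_rpow ha1.ne', sub_zero, div_mul_eq_mul_div, mul_div_assoc]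
    refine le_mul_of_one_le_right (by positivity) ?_
    have h2 : Gamma (1 - a + 1) ≤ 1 := by
      have := convexOn_Gamma.2 (x := 1) (by simp) (y := 2) (by simp) ha.1.le ha1.le (by ring)
      simp only [smul_eq_mul, Gamma_one, Gamma_two] at this
      rw [show a * 1 + (1 - a) * 2 = 1 - a + 1 by ring] at this
      linarith
    rw [Gamma_add_one ha1.ne'] at h2
    rw [inv_eq_one_div, div_div, mul_comm]
    exact (one_le_div (by positivity)).2 h2
  · filter_upwards [ae_restrict_mem measurableSet_Ioo] with s hs
    have := hs.1
    positivity

lemma ofReal_integral_rpow_le (hs : ∀ᵐ a ∂μ, a ∈ Set.Ioo (0 : ℝ) 1) {t : ℝ} (ht : 0 < t) :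
    ENNReal.ofReal (∫ a, t ^ (1 - a) ∂μ) ≤ ∫⁻ s in Set.Ioo 0 t, kdens μ s := by
  simp only [kdens]
  rw [lintegral_lintegral_swap measurable_kdens_integrand.aemeasurable,
    ofReal_integral_eq_lintegral_ofReal (integrable_of_continuousOn_of_ae_mem_Ioo hs
      (by fun_prop (disch := positivity))) (ae_of_all _ fun a => by positivity)]
  refine lintegral_mono_ae ?_
  filter_upwards [hs] with a ha using ofReal_rpow_le_setLIntegral ht ha

lemma mgf_id_pos (hμ : μ ≠ 0) (hs : ∀ᵐ a ∂μ, a ∈ Set.Ioo (0 : ℝ) 1) (x : ℝ) :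
    0 < mgf id μ x :=
  integral_pos_of_ae_mem_Ioo hμ hs (by simp only [id]; fun_prop) fun _ _ => exp_pos _

/-- The Sonine identity `k * l = 1` on `(0,∞)`. -/
lemma conv_eq_restrict_Ioi (hμ : μ ≠ 0) (hs : ∀ᵐ a ∂μ, a ∈ Set.Ioo (0 : ℝ) 1) :
    ((volume.restrict (Set.Ioi 0)).withDensity (kdens μ)).conv
      ((volume.restrict (Set.Ioi 0)).withDensity (lintegralExp (spectralMeasure μ))) =
      volume.restrict (Set.Ioi 0) := by
  have : SFinite (spectralMeasure μ) := by unfold spectralMeasure; infer_instance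
  have key : ∀ z > 0, ∫⁻ x, ENNReal.ofReal (exp (-(z * x)))
      ∂(((volume.restrict (Set.Ioi 0)).withDensity (kdens μ)).conv
      ((volume.restrict (Set.Ioi 0)).withDensity (lintegralExp (spectralMeasure μ)))) =
      ∫⁻ x in Set.Ioi (0 : ℝ), ENNReal.ofReal (exp (-(z * x))) := fun z hz => by
    rw [lintegral_exp_neg_conv, lintegral_withDensity_eq_lintegral_mul _ measurable_kdens
      (by fun_prop), lintegral_withDensity_eq_lintegral_mul _ (measurable_lintegralExp _)
      (by fun_prop)]
    simp only [Pi.mul_apply]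
    have hm := mgf_id_pos hμ hs (log z)
    rw [lintegral_exp_mul_kdens hs hz, lintegral_exp_mul_lintegralExp ae_pos_spectralMeasure hz,
      lintegral_spectralMeasure hμ hs hz, lintegral_exp_neg_mul_Ioi hz,
      ← ENNReal.ofReal_mul (by positivity)]
    congr 1
    field_simp
  refine ext_of_lintegral_exp key fun z hz => ?_
  rw [key z hz, lintegral_exp_neg_mul_Ioi hz]
  exact ENNReal.ofReal_ne_top

lemma setLIntegral_kdens_mul_lintegralExp_le (hμ : μ ≠ 0)
    (hs : ∀ᵐ a ∂μ, a ∈ Set.Ioo (0 : ℝ) 1) {t h : ℝ} (ht : 0 < t) (hh : 0 < h) :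
    (∫⁻ s in Set.Ioo 0 t, kdens μ s) * lintegralExp (spectralMeasure μ) (t + h) ≤ 1 := by
  have : SFinite (spectralMeasure μ) := by unfold spectralMeasure; infer_instance
  set ρ := spectralMeasure μ
  set E := Set.Icc t (t + h)
  have hE : MeasurableSet E := measurableSet_Icc
  have hsubE : E ⊆ Set.Ioi 0 := fun x hx => ht.trans_le hx.1
  have hconv : ∫⁻ x, E.indicator 1 x ∂(((volume.restrict (Set.Ioi 0)).withDensity (kdens μ)).conv
      ((volume.restrict (Set.Ioi 0)).withDensity (lintegralExp ρ))) = ENNReal.ofReal h := by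
    rw [conv_eq_restrict_Ioi hμ hs, lintegral_indicator_one hE, Measure.restrict_apply hE,
      Set.inter_eq_left.2 hsubE, Real.volume_Icc]
    simp
  have hind : Measurable (E.indicator (1 : ℝ → ENNReal)) := measurable_one.indicator hE
  have hinner : ∀ s ∈ Set.Ioo 0 t, lintegralExp ρ (t + h) * ENNReal.ofReal h ≤
      ∫⁻ u, E.indicator 1 (s + u) ∂(volume.restrict (Set.Ioi 0)).withDensity
        (lintegralExp ρ) := fun s hst => by
    have hsub : Set.Icc (t - s) (t + h - s) ⊆ Set.Ioi 0 := fun u hu =>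
      (sub_pos.2 hst.2).trans_le hu.1
    have hms : Measurable fun u => E.indicator (1 : ℝ → ENNReal) (s + u) :=
      hind.comp (measurable_const_add s)
    rw [lintegral_withDensity_eq_lintegral_mul _ (measurable_lintegralExp _) hms]
    calc lintegralExp ρ (t + h) * ENNReal.ofReal h
        = ∫⁻ _ in Set.Icc (t - s) (t + h - s), lintegralExp ρ (t + h) := by
          rw [setLIntegral_const, Real.volume_Icc]
          congr 2
          ring
      _ ≤ ∫⁻ u in Set.Icc (t - s) (t + h - s),
            (lintegralExp ρ * fun u => E.indicator (1 : ℝ → ENNReal) (s + u)) u := by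
          refine setLIntegral_mono' measurableSet_Icc fun u hu => ?_
          have hmem : s + u ∈ E := ⟨by linarith [hu.1], by linarith [hu.2]⟩
          rw [Pi.mul_apply, Set.indicator_of_mem hmem, Pi.one_apply, mul_one]
          exact lintegralExp_antitone ae_pos_spectralMeasure (by linarith [hu.2, hst.1])
      _ ≤ _ := lintegral_mono_set hsub
  have hle : (∫⁻ s in Set.Ioo 0 t, kdens μ s) * (lintegralExp ρ (t + h) * ENNReal.ofReal h) ≤
      ENNReal.ofReal h := by
    rw [← lintegral_mul_const (lintegralExp ρ (t + h) * ENNReal.ofReal h) measurable_kdens]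
    refine le_of_le_of_eq ?_ hconv
    rw [Measure.lintegral_conv hind, lintegral_withDensity_eq_lintegral_mul _
      measurable_kdens (Measurable.lintegral_prod_right'
        (f := fun p : ℝ × ℝ => E.indicator 1 (p.1 + p.2)) (hind.comp measurable_add))]
    refine (setLIntegral_mono' measurableSet_Ioo fun s hst => ?_).trans
      (lintegral_mono_set Set.Ioo_subset_Ioi_self)
    exact mul_le_mul_right (hinner s hst) _
  rw [← mul_assoc] at hle
  exact (ENNReal.mul_le_mul_iff_left (ENNReal.ofReal_pos.2 hh).ne' ENNReal.ofReal_ne_top).1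
    (hle.trans_eq (one_mul _).symm)

lemma lker_le (hμ : μ ≠ 0) (hs : ∀ᵐ a ∂μ, a ∈ Set.Ioo (0 : ℝ) 1) {t : ℝ} (ht : 0 < t) :
    lker μ t ≤ 1 / ∫ a, t ^ (1 - a) ∂μ := by
  have hpos : 0 < ∫ a, t ^ (1 - a) ∂μ :=
    integral_pos_of_ae_mem_Ioo hμ hs (by fun_prop (disch := positivity)) fun a _ =>
      rpow_pos_of_pos ht _
  rw [le_div_iff₀' hpos]
  have hstep : ∀ᶠ x in 𝓝[>] t, (∫ a, t ^ (1 - a) ∂μ) * lker μ x ≤ 1 := by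
    filter_upwards [self_mem_nhdsWithin] with x hx
    have hx : t < x := hx
    rw [← ENNReal.ofReal_le_one, ENNReal.ofReal_mul hpos.le, ofReal_lker hμ hs (ht.trans hx)]
    have h := setLIntegral_kdens_mul_lintegralExp_le hμ hs ht (sub_pos.2 hx)
    rw [add_sub_cancel] at h
    exact (mul_le_mul_left (ofReal_integral_rpow_le hs ht) _).trans h
  have hc : ContinuousAt (lker μ) t :=
    (contDiffOn_lker hμ hs).continuousOn.continuousAt (Ioi_mem_nhds ht)
  exact le_of_tendsto ((hc.tendsto.mono_left nhdsWithin_le_nhds).const_mul _) hstep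

end Kernels

lemma IsDistOrderMeasure.ae_mem_Ioo {μ : Measure ℝ} (hμ : IsDistOrderMeasure μ) :
    ∀ᵐ a ∂μ, a ∈ Set.Ioo (0 : ℝ) 1 := by
  obtain ⟨-, M, α, q, w, -, hα, -, -, -, rfl⟩ := hμ
  rw [ae_add_measure_iff]
  refine ⟨?_, (withDensity_absolutelyContinuous _ _).ae_le (ae_restrict_mem measurableSet_Ioo)⟩
  rw [ae_iff, Measure.finsetSum_apply]
  refine Finset.sum_eq_zero fun n _ => ?_
  have h : Measure.dirac (α n) (Set.Ioo (0 : ℝ) 1)ᶜ = 0 := by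
    rw [Measure.dirac_apply' _ measurableSet_Ioo.compl]
    simp [(hα n).1, (hα n).2]
  rw [Measure.smul_apply]
  exact (congrArg _ h).trans (smul_zero _)

/-- The kernel `l` is infinitely differentiable on `(0,∞)` and satisfies, for every `t > 0`,
the upper bound `l(t) ≤ 1 / ∫_{(0,1]} t^{1−α} dμ(α)`. -/
theorem statement3 (μ : Measure ℝ) [IsFiniteMeasure μ] (hμ : IsDistOrderMeasure μ) :
    ContDiffOn ℝ (⊤ : ℕ∞) (lker μ) (Set.Ioi 0) ∧
    ∀ t > (0:ℝ), lker μ t ≤ 1 / ∫ a in Set.Ioc (0:ℝ) 1, t ^ (1 - a) ∂μ := by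
  have hs := hμ.ae_mem_Ioo
  have hres : μ.restrict (Set.Ioc 0 1) = μ :=
    Measure.restrict_eq_self_of_ae_mem (hs.mono fun _ ha => Set.Ioo_subset_Ioc_self ha)
  rw [hres]
  exact ⟨contDiffOn_lker hμ.1 hs, fun t ht => lker_le hμ.1 hs ht⟩
end

section
/- There exists a constant c > 0, depending only on μ and γ₋, such that l(t) ≤ c · t^{γ₋−1} for every t ∈ (0,1). -/
open MeasureTheory Real

namespace IsDistOrderMeasure

theorem measure_singleton_one {μ : Measure ℝ} (hμ : IsDistOrderMeasure μ) : μ {1} = 0 := by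
  obtain ⟨-, M, α, q, w, -, hα, -, -, -, rfl⟩ := hμ
  have hac : ((volume.restrict (Set.Ioo (0:ℝ) 1)).withDensity
      fun x => ENNReal.ofReal (w x)) {1} = 0 := by
    refine withDensity_absolutelyContinuous _ _ ?_
    exact Measure.restrict_le_self.absolutelyContinuous Real.volume_singleton
  rw [Measure.add_apply, hac, add_zero, Measure.finsetSum_apply]
  refine Finset.sum_eq_zero fun n _ => ?_
  simp [(hα n).2.ne]

theorem exists_measure_Ioc_pos {μ : Measure ℝ} (hμ : IsDistOrderMeasure μ) {γ : ℝ}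
    (hγμ : 0 < μ (Set.Ioc γ 1)) : ∃ β, γ < β ∧ β < 1 ∧ 0 < μ (Set.Ioc γ β) := by
  have hsub : Set.Ioc γ 1 ⊆ (⋃ n : ℕ, Set.Ioc γ (1 - 1 / ((n : ℝ) + 1))) ∪ {1} := by
    rintro x ⟨hx, hx1⟩
    rcases hx1.lt_or_eq with h | h
    · obtain ⟨n, hn⟩ := exists_nat_one_div_lt (sub_pos.2 h)
      exact Or.inl (Set.mem_iUnion.2 ⟨n, hx, by linarith⟩)
    · exact Or.inr h
  have hU : μ (⋃ n : ℕ, Set.Ioc γ (1 - 1 / ((n : ℝ) + 1))) ≠ 0 := fun h =>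
    hγμ.ne' (measure_mono_null hsub (measure_union_null h hμ.measure_singleton_one))
  obtain ⟨n, hn⟩ := exists_measure_pos_of_not_measure_iUnion_null hU
  refine ⟨_, ?_, ?_, hn⟩
  · exact Set.nonempty_Ioc.1 (nonempty_of_measure_ne_zero hn.ne')
  · have : 0 < 1 / ((n : ℝ) + 1) := by positivity
    linarith

end IsDistOrderMeasure

theorem sin_pi_mul_nonneg {a : ℝ} (ha : a ∈ Set.Icc (0:ℝ) 1) : 0 ≤ Real.sin (Real.pi * a) :=
  Real.sin_nonneg_of_nonneg_of_le_pi (mul_nonneg Real.pi_pos.le ha.1)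
    (mul_le_of_le_one_right Real.pi_pos.le ha.2)

theorem setIntegral_sin_pi_mul_pos {μ : Measure ℝ} [IsFiniteMeasure μ] {γ β : ℝ} (hγ : 0 ≤ γ)
    (hβ : β < 1) (h : 0 < μ (Set.Ioc γ β)) :
    0 < ∫ a in Set.Ioc γ β, Real.sin (Real.pi * a) ∂μ := by
  have hpos : ∀ a ∈ Set.Ioc γ β, 0 < Real.sin (Real.pi * a) := fun a ha =>
    Real.sin_pos_of_pos_of_lt_pi (mul_pos Real.pi_pos (hγ.trans_lt ha.1))
      (mul_lt_of_lt_one_right Real.pi_pos (ha.2.trans_lt hβ))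
  rw [setIntegral_pos_iff_support_of_nonneg_ae]
  · refine h.trans_le (measure_mono fun a ha => ⟨(hpos a ha).ne', ha⟩)
  · filter_upwards [ae_restrict_mem measurableSet_Ioc] with a ha using (hpos a ha).le
  · exact Continuous.integrableOn_Ioc (by fun_prop)

theorem min_rpow_mul_le_setIntegral_rpow_mul_sin {μ : Measure ℝ} [IsFiniteMeasure μ] {γ β r : ℝ}
    (hγ : 0 ≤ γ) (hβ : β ≤ 1) (hr : 0 < r) :
    min (r ^ γ) (r ^ β) * ∫ a in Set.Ioc γ β, Real.sin (Real.pi * a) ∂μ ≤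
      ∫ a in Set.Ioc (0:ℝ) 1, r ^ a * Real.sin (Real.pi * a) ∂μ := by
  have hcont : Continuous fun a : ℝ => r ^ a * Real.sin (Real.pi * a) :=
    (continuous_const.rpow continuous_id fun _ => Or.inl hr.ne').mul (by fun_prop)
  have hsin : Continuous fun a : ℝ => min (r ^ γ) (r ^ β) * Real.sin (Real.pi * a) := by fun_prop
  calc min (r ^ γ) (r ^ β) * ∫ a in Set.Ioc γ β, Real.sin (Real.pi * a) ∂μ
      = ∫ a in Set.Ioc γ β, min (r ^ γ) (r ^ β) * Real.sin (Real.pi * a) ∂μ :=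
        (integral_const_mul _ _).symm
    _ ≤ ∫ a in Set.Ioc γ β, r ^ a * Real.sin (Real.pi * a) ∂μ := by
        refine setIntegral_mono_on hsin.integrableOn_Ioc hcont.integrableOn_Ioc
          measurableSet_Ioc fun a ha => ?_
        refine mul_le_mul_of_nonneg_right ?_
          (sin_pi_mul_nonneg ⟨hγ.trans ha.1.le, ha.2.trans hβ⟩)
        rcases le_total 1 r with h | h
        · exact (min_le_left _ _).trans (Real.rpow_le_rpow_of_exponent_le h ha.1.le)
        · exact (min_le_right _ _).trans (Real.rpow_le_rpow_of_exponent_ge hr h ha.2)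
    _ ≤ _ := by
        refine setIntegral_mono_set hcont.integrableOn_Ioc ?_
          (Set.Ioc_subset_Ioc hγ hβ).eventuallyLE
        filter_upwards [ae_restrict_mem measurableSet_Ioc] with a ha
        exact mul_nonneg (Real.rpow_nonneg hr.le a) (sin_pi_mul_nonneg ⟨ha.1.le, ha.2⟩)

theorem Hker_nonneg (μ : Measure ℝ) {r : ℝ} (hr : 0 ≤ r) : 0 ≤ Hker μ r :=
  div_nonneg (setIntegral_nonneg measurableSet_Ioc fun a ha =>
    mul_nonneg (Real.rpow_nonneg hr a) (sin_pi_mul_nonneg ⟨ha.1.le, ha.2⟩)) (by positivity)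

theorem Hker_le {μ : Measure ℝ} [IsFiniteMeasure μ] {γ β r : ℝ} (hγ : 0 ≤ γ) (hβ : β < 1)
    (h : 0 < μ (Set.Ioc γ β)) (hr : 0 < r) :
    Hker μ r ≤
      (r ^ (-γ) + r ^ (-β)) * (∫ a in Set.Ioc γ β, Real.sin (Real.pi * a) ∂μ)⁻¹ := by
  have hm := setIntegral_sin_pi_mul_pos hγ hβ h
  have hS := min_rpow_mul_le_setIntegral_rpow_mul_sin (μ := μ) hγ hβ.le hr
  unfold Hker
  set m := ∫ a in Set.Ioc γ β, Real.sin (Real.pi * a) ∂μ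
  set S := ∫ a in Set.Ioc (0:ℝ) 1, r ^ a * Real.sin (Real.pi * a) ∂μ
  set C := ∫ a in Set.Ioc (0:ℝ) 1, r ^ a * Real.cos (Real.pi * a) ∂μ
  have hγr : 0 < r ^ γ := Real.rpow_pos_of_pos hr γ
  have hβr : 0 < r ^ β := Real.rpow_pos_of_pos hr β
  have hmin : 0 < min (r ^ γ) (r ^ β) * m := mul_pos (lt_min hγr hβr) hm
  have hSpos : 0 < S := hmin.trans_le hS
  calc S / (S ^ 2 + C ^ 2) ≤ S / S ^ 2 := by
        gcongr
        exact le_add_of_nonneg_right (sq_nonneg C)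
    _ = S⁻¹ := by field_simp
    _ ≤ (min (r ^ γ) (r ^ β) * m)⁻¹ := inv_anti₀ hmin hS
    _ = (min (r ^ γ) (r ^ β))⁻¹ * m⁻¹ := mul_inv _ _
    _ ≤ _ := by
        refine mul_le_mul_of_nonneg_right ?_ (inv_nonneg.2 hm.le)
        rw [Real.rpow_neg hr.le, Real.rpow_neg hr.le]
        rcases min_choice (r ^ γ) (r ^ β) with h | h <;> rw [h]
        · exact le_add_of_nonneg_right (inv_nonneg.2 hβr.le)
        · exact le_add_of_nonneg_left (inv_nonneg.2 hγr.le)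

theorem integral_exp_neg_mul_rpow_neg {b t : ℝ} (hb : b < 1) (ht : 0 < t) :
    ∫ r in Set.Ioi (0:ℝ), Real.exp (-(r * t)) * r ^ (-b) = t ^ (b - 1) * Real.Gamma (1 - b) := by
  have h := Real.integral_rpow_mul_exp_neg_mul_Ioi (sub_pos.2 hb) ht
  rw [one_div, Real.inv_rpow ht.le, ← Real.rpow_neg ht.le, neg_sub] at h
  rw [← h]
  refine integral_congr_ae (Filter.Eventually.of_forall fun r => ?_)
  simp only [mul_comm r t, sub_sub_cancel_left, mul_comm (r ^ (-b))]

theorem integrableOn_exp_neg_mul_rpow_neg {b t : ℝ} (hb : b < 1) (ht : 0 < t) :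
    IntegrableOn (fun r : ℝ => Real.exp (-(r * t)) * r ^ (-b)) (Set.Ioi 0) := by
  refine Integrable.of_integral_ne_zero ?_
  rw [integral_exp_neg_mul_rpow_neg hb ht]
  exact (mul_pos (Real.rpow_pos_of_pos ht _) (Real.Gamma_pos_of_pos (sub_pos.2 hb))).ne'

/-- There exists `c > 0`, depending only on `μ` and `γ₋`, such that `l(t) ≤ c · t^{γ₋−1}`
for every `t ∈ (0,1)`. -/
theorem statement5 (μ : Measure ℝ) [IsFiniteMeasure μ] (hμ : IsDistOrderMeasure μ)
    (γ : ℝ) (hγ : γ ∈ Set.Ioo (0:ℝ) 1) (hγμ : 0 < μ (Set.Ioc γ 1)) :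
    ∃ c : ℝ, 0 < c ∧ ∀ t ∈ Set.Ioo (0:ℝ) 1, lker μ t ≤ c * t ^ (γ - 1) := by
  obtain ⟨β, hγβ, hβ, hpos⟩ := hμ.exists_measure_Ioc_pos hγμ
  have hm := setIntegral_sin_pi_mul_pos hγ.1.le hβ hpos
  have hle := fun r (hr : 0 < r) => Hker_le hγ.1.le hβ hpos hr
  set m := ∫ a in Set.Ioc γ β, Real.sin (Real.pi * a) ∂μ
  have hΓγ := Real.Gamma_pos_of_pos (sub_pos.2 hγ.2)
  have hΓβ := Real.Gamma_pos_of_pos (sub_pos.2 hβ)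
  refine ⟨1 / Real.pi * ((Real.Gamma (1 - γ) + Real.Gamma (1 - β)) * m⁻¹), by positivity,
    fun t ht => ?_⟩
  have hiγ := integrableOn_exp_neg_mul_rpow_neg hγ.2 ht.1
  have hiβ := integrableOn_exp_neg_mul_rpow_neg hβ ht.1
  have hpow : t ^ (β - 1) ≤ t ^ (γ - 1) :=
    Real.rpow_le_rpow_of_exponent_ge ht.1 ht.2.le (by linarith)
  rw [lker, mul_assoc (1 / Real.pi)]
  refine mul_le_mul_of_nonneg_left ?_ (by positivity)
  calc ∫ r in Set.Ioi (0:ℝ), Real.exp (-(r * t)) * Hker μ r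
      ≤ ∫ r in Set.Ioi (0:ℝ),
          (Real.exp (-(r * t)) * r ^ (-γ) + Real.exp (-(r * t)) * r ^ (-β)) * m⁻¹ := by
        refine integral_mono_of_nonneg ?_ ((hiγ.add hiβ).mul_const _) ?_
        · filter_upwards [ae_restrict_mem measurableSet_Ioi] with r hr
          exact mul_nonneg (Real.exp_pos _).le (Hker_nonneg μ (le_of_lt hr))
        · filter_upwards [ae_restrict_mem measurableSet_Ioi] with r hr
          rw [← mul_add, mul_assoc]
          exact mul_le_mul_of_nonneg_left (hle r hr) (Real.exp_pos _).le
    _ = (t ^ (γ - 1) * Real.Gamma (1 - γ) + t ^ (β - 1) * Real.Gamma (1 - β)) * m⁻¹ := by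
        rw [integral_mul_const, integral_add hiγ hiβ,
          integral_exp_neg_mul_rpow_neg hγ.2 ht.1, integral_exp_neg_mul_rpow_neg hβ ht.1]
    _ ≤ (t ^ (γ - 1) * Real.Gamma (1 - γ) + t ^ (γ - 1) * Real.Gamma (1 - β)) * m⁻¹ := by
        gcongr
    _ = _ := by ring
end
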